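/- arXiv:1405.5449 — 2 statements merged into one kernel-verified Lean document; each statement's English description precedes it below -/
import Mathlib

section
/- Fix an integer d ≥ 1 and a real α > d; set q = d/(α−d) and, for T > e, a(T) = (T/log T)^q and r(T) = (T/log T)^{q+1}. For s, R > 0 define ℰ²_T(s,R) = (R/log T)(log s − log R + 1 + log(2d) + (q+1) log log T). Let T > e, let s, R > 0, and let N be a Poisson random variable with parameter 2dsT. Then P(N ≥ R·r(T)) ≤ exp(−a(T)·T·(qR − ℰ²_T(s,R))). -/
open MeasureTheory ProbabilityTheory Real

open scoped NNReal Nat in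
/-- The exponential series of the moment generating function of a Poisson law. -/
lemma hasSum_mgf_poissonMeasure (r : ℝ≥0) (t : ℝ) :
    HasSum (fun n : ℕ ↦ exp (-r) * (r : ℝ) ^ n / n ! * exp (t * n))
      (exp (r * (exp t - 1))) := by
  convert! (NormedSpace.expSeries_div_hasSum_exp ((r : ℝ) * exp t)).mul_left (exp (-r)) using 1
  · ext n
    rw [mul_pow, mul_comm t, exp_nat_mul]
    ring
  · rw [← exp_eq_exp_ℝ, ← exp_add]
    ring_nf

open scoped NNReal in
lemma integrable_exp_mul_poissonMeasure (r : ℝ≥0) (t : ℝ) :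
    Integrable (fun n : ℕ ↦ exp (t * n)) (poissonMeasure r) := by
  rw [integrable_poissonMeasure_iff]
  simpa using (hasSum_mgf_poissonMeasure r t).summable

open scoped NNReal in
lemma mgf_natCast_poissonMeasure (r : ℝ≥0) (t : ℝ) :
    mgf (fun n : ℕ ↦ (n : ℝ)) (poissonMeasure r) t = exp (r * (exp t - 1)) := by
  rw [mgf, integral_poissonMeasure]
  exact (hasSum_mgf_poissonMeasure r t).tsum_eq

open scoped NNReal in
/-- **Chernoff bound** for the upper tail of a Poisson law: `P(N ≥ x) ≤ (e r / x) ^ x`. -/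
lemma poissonMeasure_real_ge_le (r : ℝ≥0) (hr : 0 < r) {x : ℝ} (hx : 0 < x) :
    (poissonMeasure r).real {n : ℕ | x ≤ n} ≤ exp (x * (1 + log r - log x)) := by
  have hr' : (0 : ℝ) < r := hr
  rcases le_total (r : ℝ) x with h | h
  · have hlog : log r ≤ log x := log_le_log hr' h
    refine (measure_ge_le_exp_mul_mgf x (sub_nonneg.2 hlog)
      (integrable_exp_mul_poissonMeasure r _)).trans ?_
    rw [mgf_natCast_poissonMeasure, exp_sub, exp_log hx, exp_log hr', ← exp_add, exp_le_exp,
      mul_sub, mul_div_cancel₀ x hr'.ne']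
    linarith
  · have hlog : log x ≤ log r := log_le_log hx h
    refine measureReal_le_one.trans (one_le_exp (mul_nonneg hx.le ?_))
    linarith

/-- **Lemma 2.4 (Poisson tail bound for the number of jumps).**
With `q = d/(α-d)`, `a(T) = (T/log T)^q`, `r(T) = (T/log T)^(q+1)` and
`ℰ²_T(s,R) = (R/log T)(log s − log R + 1 + log(2d) + (q+1) log log T)`,
if `N` is Poisson with parameter `2dsT` then
`P(N ≥ R·r(T)) ≤ exp(−a(T)·T·(qR − ℰ²_T(s,R)))`. -/
theorem poisson_jump_tail
    {Ω : Type} [MeasurableSpace Ω] (μpr : Measure Ω) [IsProbabilityMeasure μpr]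
    (d : ℕ) (hd : 1 ≤ d) (α : ℝ) (hα : (d : ℝ) < α)
    (q : ℝ) (hq : q = d / (α - d))
    (T : ℝ) (hT : Real.exp 1 < T)
    (aT rT : ℝ) (haT : aT = (T / Real.log T) ^ q) (hrT : rT = (T / Real.log T) ^ (q + 1))
    (s R : ℝ) (hs : 0 < s) (hR : 0 < R)
    (E2 : ℝ)
    (hE2 : E2 = (R / Real.log T) *
      (Real.log s - Real.log R + 1 + Real.log (2 * d) + (q + 1) * Real.log (Real.log T)))
    (N : Ω → ℕ)
    (hN : Measurable N)
    (hPoisson : ∀ k : ℕ, μpr {ω | N ω = k} =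
      ENNReal.ofReal (Real.exp (-(2 * d * s * T)) * (2 * d * s * T) ^ k / (Nat.factorial k))) :
    μpr {ω | R * rT ≤ (N ω : ℝ)} ≤ ENNReal.ofReal (Real.exp (-(aT * T * (q * R - E2)))) := by
  have hT0 : 0 < T := (exp_pos 1).trans hT
  have hL1 : 1 < log T := (lt_log_iff_exp_lt hT0).2 hT
  have hL : 0 < log T := one_pos.trans hL1
  have hd0 : (0 : ℝ) < d := by exact_mod_cast hd
  have hr0 : 0 < 2 * d * s * T := by positivity
  have hTL : 0 < T / log T := div_pos hT0 hL
  have hrT0 : 0 < rT := hrT ▸ rpow_pos_of_pos hTL _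
  have hlog_rT : log rT = (q + 1) * (log T - log (log T)) := by
    rw [hrT, log_rpow hTL, log_div hT0.ne' hL.ne']
  have haT_mul : aT * T = rT * log T := by
    rw [haT, hrT, rpow_add hTL, rpow_one]
    field_simp
  have hlaw : μpr.map N = poissonMeasure (NNReal.mk (2 * d * s * T) hr0.le) := by
    refine Measure.ext_of_singleton fun k ↦ ?_
    rw [Measure.map_apply hN (measurableSet_singleton k), poissonMeasure_singleton]
    exact hPoisson k
  have hmap : μpr {ω | R * rT ≤ (N ω : ℝ)} = μpr.map N {n : ℕ | R * rT ≤ n} :=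
    (Measure.map_apply hN (.of_discrete (s := {n : ℕ | R * rT ≤ n}))).symm
  rw [hmap, hlaw, ← ofReal_measureReal]
  refine ENNReal.ofReal_le_ofReal
    ((poissonMeasure_real_ge_le _ hr0 (mul_pos hR hrT0)).trans_eq (congrArg exp ?_))
  rw [NNReal.coe_mk, log_mul hR.ne' hrT0.ne', hlog_rT, haT_mul, hE2,
    log_mul (by positivity) hT0.ne', log_mul (by positivity) hs.ne']
  field_simp
  ring
end

section
/- Let z ∈ L_T and suppose that h_T(z) = ∑_{j=1}^n q|y_{j−1} − y_j|/ξ_T(y_j) for pairwise distinct points y_0, …, y_n ∈ L_T with y_0 = z and y_n = 0. Then: (a) for every k ∈ {1, …, n}, h_T(y_k) = ∑_{j=k+1}^n q|y_{j−1} − y_j|/ξ_T(y_j); and (b) the sequence ξ_T(y_1) ≥ ξ_T(y_2) ≥ … ≥ ξ_T(y_n) is non-increasing. -/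
open MeasureTheory ProbabilityTheory Real

noncomputable section

/-- The ℓ¹-norm on `ℝ^d`. -/
def l1 {d : ℕ} (z : Fin d → ℝ) : ℝ := ∑ i, |z i|

/-- Membership in the rescaled lattice `L_T = {z ∈ ℝ^d : r(T) z ∈ ℤ^d}`. -/
def inLatt {d : ℕ} (rT : ℝ) (z : Fin d → ℝ) : Prop := ∀ i, ∃ m : ℤ, rT * z i = (m : ℝ)

/-- The rescaled potential `ξ_T(z) = ξ(r(T) z) / a(T)` built from the environment `ξ` on `ℤ^d`. -/
def envPot {Ω : Type*} {d : ℕ} (aT rT : ℝ) (ξ : (Fin d → ℤ) → Ω → ℝ) (ω : Ω)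
    (z : Fin d → ℝ) : ℝ :=
  ξ (fun i => ⌊rT * z i⌋) ω / aT

/-- The cost `∑_{j=1}^n q|y_{j-1} - y_j| / ξ_T(y_j)` of the path `y 0, …, y n`. -/
def pathCost {d : ℕ} (q : ℝ) (ξT : (Fin d → ℝ) → ℝ) (n : ℕ) (y : ℕ → Fin d → ℝ) : ℝ :=
  ∑ j ∈ Finset.range n, q * l1 (y j - y (j + 1)) / ξT (y (j + 1))

/-- The lilypad hitting time `h_T(z)`. -/
def hitTime {d : ℕ} (q rT : ℝ) (ξT : (Fin d → ℝ) → ℝ) (z : Fin d → ℝ) : ℝ :=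
  sInf {s : ℝ | ∃ n : ℕ, 1 ≤ n ∧ ∃ y : ℕ → Fin d → ℝ,
    (∀ j ≤ n, inLatt rT (y j)) ∧ y 0 = z ∧ y n = 0 ∧ s = pathCost q ξT n y}

/-- The rounding `[x]_T` of `x ∈ ℝ^d` to the lattice `L_T`. -/
def roundT {d : ℕ} (rT : ℝ) (x : Fin d → ℝ) : Fin d → ℝ := fun i => (⌊rT * x i⌋ : ℝ) / rT

/-- The PAM lilypad hitting time `τ_T(z) = inf_y q(|y| + |z-y|)/ξ_T(y)`. -/
def tauT {d : ℕ} (q rT : ℝ) (ξT : (Fin d → ℝ) → ℝ) (z : Fin d → ℝ) : ℝ :=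
  sInf {s : ℝ | ∃ y : Fin d → ℝ, inLatt rT y ∧ s = q * (l1 y + l1 (z - y)) / ξT y}

/-- The BRW lilypad profile `m_T(z,t) = sup_y { ξ_T(y)(t - h_T(y))_+ - q|z-y| }`. -/
def mT {d : ℕ} (q rT : ℝ) (ξT : (Fin d → ℝ) → ℝ) (z : Fin d → ℝ) (t : ℝ) : ℝ :=
  sSup {v : ℝ | ∃ y : Fin d → ℝ, inLatt rT y ∧
    v = ξT y * max (t - hitTime q rT ξT y) 0 - q * l1 (z - y)}

/-- The PAM lilypad profile `λ_T(z,t) = sup_y { ξ_T(y) t - q|y| - q|z-y| } ∨ 0`. -/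
def lamT {d : ℕ} (q rT : ℝ) (ξT : (Fin d → ℝ) → ℝ) (z : Fin d → ℝ) (t : ℝ) : ℝ :=
  max (sSup {v : ℝ | ∃ y : Fin d → ℝ, inLatt rT y ∧
    v = ξT y * t - q * l1 y - q * l1 (z - y)}) 0

/-- `a(T) = (T / log T)^q`. -/
def aOf (q T : ℝ) : ℝ := (T / Real.log T) ^ q

/-- `r(T) = (T / log T)^(q+1)`. -/
def rOf (q T : ℝ) : ℝ := (T / Real.log T) ^ (q + 1)

end

theorem l1_nonneg {d : ℕ} (z : Fin d → ℝ) : 0 ≤ l1 z :=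
  Finset.sum_nonneg fun _ _ => abs_nonneg _

theorem l1_sub_le {d : ℕ} (x y z : Fin d → ℝ) : l1 (x - z) ≤ l1 (x - y) + l1 (y - z) := by
  unfold l1
  rw [← Finset.sum_add_distrib]
  exact Finset.sum_le_sum fun i _ => abs_sub_le (x i) (y i) (z i)

theorem l1_sub_pos {d : ℕ} {x y : Fin d → ℝ} (h : x ≠ y) : 0 < l1 (x - y) := by
  obtain ⟨i, hi⟩ := Function.ne_iff.mp h
  exact Finset.sum_pos' (fun _ _ => abs_nonneg _)
    ⟨i, Finset.mem_univ i, abs_pos.mpr (sub_ne_zero.mpr hi)⟩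

theorem inLatt_zero {d : ℕ} (rT : ℝ) : inLatt rT (0 : Fin d → ℝ) :=
  fun _ => ⟨0, by simp⟩

section HittingTime

variable {d : ℕ} {q rT : ℝ} {ξT : (Fin d → ℝ) → ℝ}

theorem pathCost_nonneg (hq : 0 ≤ q) (hpos : ∀ z, inLatt rT z → 0 < ξT z)
    {n : ℕ} {y : ℕ → Fin d → ℝ} (hy : ∀ j ≤ n, inLatt rT (y j)) : 0 ≤ pathCost q ξT n y :=
  Finset.sum_nonneg fun _ hj => div_nonneg (mul_nonneg hq (l1_nonneg _))
    (hpos _ (hy _ (Finset.mem_range.mp hj))).le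

theorem hitTime_le_pathCost (hq : 0 ≤ q) (hpos : ∀ z, inLatt rT z → 0 < ξT z)
    {n : ℕ} (hn : 1 ≤ n) {y : ℕ → Fin d → ℝ} (hy : ∀ j ≤ n, inLatt rT (y j)) (hyn : y n = 0) :
    hitTime q rT ξT (y 0) ≤ pathCost q ξT n y := by
  refine csInf_le ⟨0, ?_⟩ ⟨n, hn, y, hy, rfl, hyn, rfl⟩
  rintro _ ⟨m, -, w, hw, -, -, rfl⟩
  exact pathCost_nonneg hq hpos hw

theorem le_hitTime {z : Fin d → ℝ} (hz : inLatt rT z) {c : ℝ}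
    (h : ∀ n : ℕ, 1 ≤ n → ∀ y : ℕ → Fin d → ℝ, (∀ j ≤ n, inLatt rT (y j)) → y 0 = z → y n = 0 →
      c ≤ pathCost q ξT n y) :
    c ≤ hitTime q rT ξT z := by
  refine le_csInf ⟨_, 1, le_rfl, fun j => if j = 0 then z else 0, fun j _ => ?_, ?_, ?_, rfl⟩ ?_
  · dsimp only
    split_ifs
    exacts [hz, inLatt_zero rT]
  · simp
  · simp
  · rintro _ ⟨n, hn, y, hy, hy0, hyn, rfl⟩
    exact h n hn y hy hy0 hyn

theorem hitTime_zero (hq : 0 ≤ q) (hpos : ∀ z, inLatt rT z → 0 < ξT z) :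
    hitTime q rT ξT 0 = 0 := by
  refine le_antisymm ?_ (le_hitTime (inLatt_zero rT) fun n _ y hy _ _ => pathCost_nonneg hq hpos hy)
  simpa [pathCost, l1] using
    hitTime_le_pathCost hq hpos le_rfl (y := fun _ => 0) (fun _ _ => inLatt_zero rT) rfl

/-- Prepending one step to a path bounds the hitting time of its new starting point. -/
theorem hitTime_le_step_add (hq : 0 ≤ q) (hpos : ∀ z, inLatt rT z → 0 < ξT z)
    {x w : Fin d → ℝ} (hx : inLatt rT x) (hw : inLatt rT w) :
    hitTime q rT ξT x ≤ q * l1 (x - w) / ξT w + hitTime q rT ξT w := by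
  rw [← sub_le_iff_le_add']
  refine le_hitTime hw fun n _ y hy hy0 hyn => ?_
  rw [sub_le_iff_le_add']
  let v : ℕ → Fin d → ℝ := fun j => Nat.casesOn j x y
  have hv : ∀ j ≤ n + 1, inLatt rT (v j) := by
    rintro (_ | j) hj
    exacts [hx, hy j (by lia)]
  refine (hitTime_le_pathCost hq hpos (by lia : 1 ≤ n + 1) hv hyn).trans_eq ?_
  rw [pathCost, Finset.sum_range_succ', add_comm, ← hy0]
  rfl

theorem hitTime_le_sum_Ico_add (hq : 0 ≤ q) (hpos : ∀ z, inLatt rT z → 0 < ξT z)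
    {y : ℕ → Fin d → ℝ} {k m : ℕ} (hkm : k ≤ m) (hy : ∀ j ≤ m, inLatt rT (y j)) :
    hitTime q rT ξT (y k) ≤
      ∑ j ∈ Finset.Ico k m, q * l1 (y j - y (j + 1)) / ξT (y (j + 1)) +
        hitTime q rT ξT (y m) := by
  induction m, hkm using Nat.le_induction with
  | base => simp
  | succ m hkm ih =>
    rw [Finset.sum_Ico_succ_top hkm]
    linarith [ih fun j hj => hy j (by lia),
      hitTime_le_step_add hq hpos (hy m (by lia)) (hy (m + 1) le_rfl)]

/-- The tails of an optimal path are optimal. -/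
theorem hitTime_eq_sum_Ico (hq : 0 ≤ q) (hpos : ∀ z, inLatt rT z → 0 < ξT z)
    {n : ℕ} {y : ℕ → Fin d → ℝ} (hy : ∀ j ≤ n, inLatt rT (y j)) (hyn : y n = 0)
    (hopt : hitTime q rT ξT (y 0) = pathCost q ξT n y) {k : ℕ} (hk : k ≤ n) :
    hitTime q rT ξT (y k) =
      ∑ j ∈ Finset.Ico k n, q * l1 (y j - y (j + 1)) / ξT (y (j + 1)) := by
  apply le_antisymm
  · simpa [hyn, hitTime_zero hq hpos] using hitTime_le_sum_Ico_add hq hpos hk hy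
  · have hhead := hitTime_le_sum_Ico_add hq hpos k.zero_le fun j hj => hy j (hj.trans hk)
    rw [hopt, pathCost, Finset.range_eq_Ico, ← Finset.sum_Ico_consecutive _ k.zero_le hk] at hhead
    linarith

end HittingTime

/-- **Lemma 3.3.** If the infimum defining `h_T(z)` is attained along a path of pairwise
distinct points `y 0 = z, …, y n = 0` in `L_T`, then (a) each `h_T(y k)` is attained along
the corresponding tail of the path, and (b) the potential is non-increasing along the path. -/
theorem optimal_path_structure
    (d : ℕ) (hd : 1 ≤ d) (α : ℝ) (hα : (d : ℝ) < α)
    (q : ℝ) (hq : q = d / (α - d))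
    (T : ℝ) (hT : Real.exp 1 < T)
    (rT : ℝ) (hrT : rT = rOf q T)
    (ξT : (Fin d → ℝ) → ℝ) (hpos : ∀ z, inLatt rT z → 0 < ξT z)
    (z : Fin d → ℝ) (hz : inLatt rT z)
    (n : ℕ) (hn : 1 ≤ n) (y : ℕ → Fin d → ℝ)
    (hlatt : ∀ j ≤ n, inLatt rT (y j))
    (hy0 : y 0 = z) (hyn : y n = 0)
    (hdist : ∀ i j, i ≤ n → j ≤ n → y i = y j → i = j)
    (hopt : hitTime q rT ξT z = pathCost q ξT n y) :
    (∀ k, 1 ≤ k → k ≤ n →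
      hitTime q rT ξT (y k) = ∑ j ∈ Finset.Ico k n, q * l1 (y j - y (j + 1)) / ξT (y (j + 1)))
    ∧ (∀ j, 1 ≤ j → j < n → ξT (y (j + 1)) ≤ ξT (y j)) := by
  have hq0 : 0 < q := by
    rw [hq]
    exact div_pos (by exact_mod_cast hd) (sub_pos.mpr hα)
  subst hy0
  have htail := fun {k : ℕ} (hk : k ≤ n) => hitTime_eq_sum_Ico hq0.le hpos hlatt hyn hopt hk
  refine ⟨fun k _ hk => htail hk, fun j hj hjn => ?_⟩
  obtain ⟨i, rfl⟩ := Nat.exists_eq_add_of_le' hj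
  by_contra! hlt
  have hshort := hitTime_le_step_add hq0.le hpos (hlatt i (by lia)) (hlatt (i + 1 + 1) hjn)
  rw [htail (by lia : i ≤ n), htail (by lia : i + 1 + 1 ≤ n),
    Finset.sum_eq_sum_Ico_succ_bot (by lia : i < n),
    Finset.sum_eq_sum_Ico_succ_bot (by lia : i + 1 < n)] at hshort
  have hne : y i ≠ y (i + 1) := fun h => by
    have := hdist i (i + 1) (by lia) (by lia) h
    lia
  have hstep : q * l1 (y i - y (i + 1)) / ξT (y (i + 1 + 1)) <
      q * l1 (y i - y (i + 1)) / ξT (y (i + 1)) :=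
    div_lt_div_of_pos_left (mul_pos hq0 (l1_sub_pos hne)) (hpos _ (hlatt _ (by lia))) hlt
  have htri : q * l1 (y i - y (i + 1 + 1)) / ξT (y (i + 1 + 1)) ≤
      q * l1 (y i - y (i + 1)) / ξT (y (i + 1 + 1)) +
        q * l1 (y (i + 1) - y (i + 1 + 1)) / ξT (y (i + 1 + 1)) := by
    rw [← add_div, ← mul_add]
    exact div_le_div_of_nonneg_right (mul_le_mul_of_nonneg_left (l1_sub_le _ _ _) hq0.le)
      (hpos _ (hlatt _ hjn)).le
  linarith
end
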